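/- For every integer n ≥ 4, the number of elements of the sumset U + U that are less than F_n equals 2·F_{n−2} + 2 − n. (Formally: the cardinality of the finite set {m ∈ ℕ : m < F_n and m ∈ U + U} is 2·F_{n−2} + 2 − n.) -/

import Mathlib

noncomputable def phi : ℝ := (1 + Real.sqrt 5) / 2

/-- The lower Wythoff set `L = {⌊i·φ⌋ : i ≥ 1}`. -/
def lowerWythoff : Set ℕ := {n | ∃ i : ℕ, 1 ≤ i ∧ n = ⌊(i : ℝ) * phi⌋₊}

/-- The upper Wythoff set `U = {⌊i·φ²⌋ : i ≥ 1}`. -/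
def upperWythoff : Set ℕ := {n | ∃ i : ℕ, 1 ≤ i ∧ n = ⌊(i : ℝ) * phi ^ 2⌋₊}

theorem phi_eq_goldenRatio : phi = Real.goldenRatio := rfl

/-- The `i`-th upper Wythoff number. -/
noncomputable def upperW (i : ℕ) : ℕ := ⌊(i : ℝ) * phi ^ 2⌋₊

/-- The fractional part of `i·φ²`. -/
noncomputable def upperFract (i : ℕ) : ℝ := (i : ℝ) * phi ^ 2 - upperW i

theorem phi_sq : phi ^ 2 = phi + 1 := Real.goldenRatio_sq

theorem two_lt_phi_sq : 2 < phi ^ 2 := by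
  rw [phi_sq]
  have := Real.one_lt_goldenRatio
  rw [← phi_eq_goldenRatio] at this
  linarith

theorem upperFract_nonneg (i : ℕ) : 0 ≤ upperFract i :=
  sub_nonneg.2 (Nat.floor_le (by positivity))

theorem upperFract_lt_one (i : ℕ) : upperFract i < 1 := by
  have := Nat.lt_floor_add_one ((i : ℝ) * phi ^ 2)
  unfold upperFract upperW
  linarith

theorem upperFract_pos {i : ℕ} (hi : 0 < i) : 0 < upperFract i := by
  refine lt_of_le_of_ne (upperFract_nonneg i) fun h => ?_
  have hirr : Irrational ((i : ℝ) * (phi + 1)) := by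
    have := (Real.goldenRatio_irrational.add_natCast 1).natCast_mul hi.ne'
    simpa [phi_eq_goldenRatio] using this
  refine hirr.ne_nat (upperW i) ?_
  rw [← phi_sq]
  unfold upperFract at h
  linarith

theorem upperW_eq {i m : ℕ} (h₀ : 0 ≤ (i : ℝ) * phi ^ 2 - m) (h₁ : (i : ℝ) * phi ^ 2 - m < 1) :
    upperW i = m :=
  (Nat.floor_eq_iff (by positivity)).2 ⟨by linarith, by linarith⟩

theorem upperW_add_two_le {i j : ℕ} (h : i < j) : upperW i + 2 ≤ upperW j := by
  have hij : (i : ℝ) + 1 ≤ j := by exact_mod_cast h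
  have hi := Nat.floor_le (a := (i : ℝ) * phi ^ 2) (by positivity)
  refine Nat.le_floor ?_
  push_cast
  change ((⌊(i : ℝ) * phi ^ 2⌋₊ : ℕ) : ℝ) + 2 ≤ _
  nlinarith [two_lt_phi_sq]

theorem upperW_strictMono : StrictMono upperW := fun _ _ h => by
  have := upperW_add_two_le h
  omega

theorem two_le_upperW {i : ℕ} (hi : 0 < i) : 2 ≤ upperW i := by
  have := upperW_add_two_le hi
  omega

theorem upperW_ne_add_one (i j : ℕ) : upperW i ≠ upperW j + 1 := by
  intro h
  rcases lt_trichotomy i j with hij | rfl | hij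
  · have := upperW_add_two_le hij
    omega
  · omega
  · have := upperW_add_two_le hij
    omega

theorem upperFract_add (k l : ℕ) :
    upperFract k + upperFract l - upperFract (k + l)
      = (upperW (k + l) : ℝ) - (upperW k + upperW l : ℕ) := by
  unfold upperFract
  push_cast
  ring

theorem upperW_add_cases (k l : ℕ) :
    (upperW (k + l) = upperW k + upperW l ∧
      upperFract (k + l) = upperFract k + upperFract l) ∨
    (upperW (k + l) = upperW k + upperW l + 1 ∧
      upperFract (k + l) + 1 = upperFract k + upperFract l) := by
  have h := upperFract_add k l
  have hk := upperFract_nonneg k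
  have hl := upperFract_nonneg l
  have hkl := upperFract_nonneg (k + l)
  have hk' := upperFract_lt_one k
  have hl' := upperFract_lt_one l
  have hkl' := upperFract_lt_one (k + l)
  have h₁ : upperW k + upperW l < upperW (k + l) + 1 := by
    have : ((upperW k + upperW l : ℕ) : ℝ) < (upperW (k + l) + 1 : ℕ) := by
      push_cast at h ⊢
      linarith
    exact_mod_cast this
  have h₂ : upperW (k + l) < upperW k + upperW l + 2 := by
    have : (upperW (k + l) : ℝ) < (upperW k + upperW l + 2 : ℕ) := by
      push_cast at h ⊢
      linarith
    exact_mod_cast this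
  rcases (by omega : upperW (k + l) = upperW k + upperW l ∨
    upperW (k + l) = upperW k + upperW l + 1) with h₃ | h₃
  · refine .inl ⟨h₃, ?_⟩
    rw [h₃] at h
    linarith
  · refine .inr ⟨h₃, ?_⟩
    rw [h₃] at h
    push_cast at h
    linarith

theorem exists_add_eq_upperW_iff (i : ℕ) :
    (∃ k l, 0 < k ∧ 0 < l ∧ upperW k + upperW l = upperW i) ↔
      ∃ k, 0 < k ∧ k < i ∧ upperFract k < upperFract i := by
  constructor
  · rintro ⟨k, l, hk, hl, h⟩
    rcases upperW_add_cases k l with ⟨h₁, h₂⟩ | ⟨h₁, -⟩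
    · obtain rfl : k + l = i := upperW_strictMono.injective (h₁.trans h)
      exact ⟨k, hk, by omega, by linarith [upperFract_pos hl]⟩
    · exact absurd (h₁.trans (by rw [h])) (upperW_ne_add_one (k + l) i)
  · rintro ⟨k, hk, hki, h⟩
    obtain ⟨l, rfl⟩ := Nat.exists_eq_add_of_lt hki
    refine ⟨k, l + 1, hk, l.succ_pos, ?_⟩
    rw [add_assoc] at *
    rcases upperW_add_cases k (l + 1) with ⟨h₁, -⟩ | ⟨-, h₂⟩
    · exact h₁.symm
    · linarith [upperFract_lt_one (l + 1)]

theorem exists_add_add_one_eq_upperW_iff (i : ℕ) :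
    (∃ k l, 0 < k ∧ 0 < l ∧ upperW k + upperW l + 1 = upperW i) ↔
      ∃ k, 0 < k ∧ k < i ∧ upperFract i < upperFract k := by
  constructor
  · rintro ⟨k, l, hk, hl, h⟩
    rcases upperW_add_cases k l with ⟨h₁, -⟩ | ⟨h₁, h₂⟩
    · exact absurd (h.symm.trans (by rw [h₁])) (upperW_ne_add_one i (k + l))
    · obtain rfl : k + l = i := upperW_strictMono.injective (h₁.trans h)
      exact ⟨k, hk, by omega, by linarith [upperFract_lt_one l]⟩
  · rintro ⟨k, hk, hki, h⟩
    obtain ⟨l, rfl⟩ := Nat.exists_eq_add_of_lt hki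
    refine ⟨k, l + 1, hk, l.succ_pos, ?_⟩
    rw [add_assoc] at *
    rcases upperW_add_cases k (l + 1) with ⟨-, h₂⟩ | ⟨h₁, -⟩
    · linarith [upperFract_nonneg (l + 1)]
    · exact h₁.symm

theorem fib_mul_phi_sq (n : ℕ) :
    (Nat.fib n : ℝ) * phi ^ 2 = Nat.fib (n + 2) - Real.goldenConj ^ n := by
  have h := Real.fib_succ_sub_goldenRatio_mul_fib n
  rw [← phi_eq_goldenRatio] at h
  rw [phi_sq, Nat.fib_add_two]
  push_cast
  linarith

theorem exists_int_combination_fib (k p : ℤ) (n : ℕ) :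
    ∃ a b : ℤ, k = a * Nat.fib n + b * Nat.fib (n + 1) ∧
      p = a * Nat.fib (n + 2) + b * Nat.fib (n + 3) := by
  induction n with
  | zero => exact ⟨p - 2 * k, k, by simp, by simp [Nat.fib_add_two]; ring⟩
  | succ n ih =>
    obtain ⟨a, b, h₁, h₂⟩ := ih
    refine ⟨b - a, a, ?_, ?_⟩
    · rw [h₁, Nat.fib_add_two (n := n)]
      push_cast
      ring
    · rw [h₂, Nat.fib_add_two (n := n + 2)]
      push_cast
      ring

/-- The Fibonacci numbers give the best one-sided approximations of `φ²`. -/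
theorem eq_fib_of_approx {n k : ℕ} (hk : 0 < k) (hkn : k < Nat.fib (n + 2)) (p : ℤ) {θ : ℝ}
    (h : (k : ℝ) * phi ^ 2 - p = -Real.goldenConj ^ n * θ) (h₀ : 0 < θ) (h₁ : θ ≤ 1) :
    k = Nat.fib n := by
  obtain ⟨a, b, hka, hpa⟩ := exists_int_combination_fib k p n
  have hneg := Real.goldenConj_neg
  have hθ : θ = a + b * Real.goldenConj := by
    have hk' : (k : ℝ) = a * Nat.fib n + b * Nat.fib (n + 1) := by exact_mod_cast hka
    have hp' : (p : ℝ) = a * Nat.fib (n + 2) + b * Nat.fib (n + 3) := by exact_mod_cast hpa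
    have e₁ := fib_mul_phi_sq n
    have e₂ := fib_mul_phi_sq (n + 1)
    refine mul_left_cancel₀ (neg_ne_zero.2 (pow_ne_zero n hneg.ne)) ?_
    rw [← h, hk', hp']
    rw [show n + 1 + 2 = n + 3 from rfl, pow_succ] at e₂
    linear_combination (a : ℝ) * e₁ + (b : ℝ) * e₂
  have hfib : (Nat.fib (n + 2) : ℤ) = Nat.fib n + Nat.fib (n + 1) := by
    exact_mod_cast Nat.fib_add_two
  have hkn' : (k : ℤ) < Nat.fib (n + 2) := by exact_mod_cast hkn
  have hk' : (0 : ℤ) < k := by exact_mod_cast hk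
  have f₀ : (0 : ℤ) ≤ Nat.fib n := by positivity
  have f₁ : (0 : ℤ) ≤ Nat.fib (n + 1) := by positivity
  rcases lt_trichotomy b 0 with hb | rfl | hb
  · have hb' : (b : ℝ) < 0 := by exact_mod_cast hb
    have : (a : ℝ) < 1 := by nlinarith
    have ha : a < 1 := by exact_mod_cast this
    nlinarith
  · have ha₁ : (a : ℝ) ≤ 1 := by simpa [hθ] using h₁
    have ha₀ : (0 : ℝ) < a := by simpa [hθ] using h₀
    have ha₁' : a ≤ 1 := by exact_mod_cast ha₁
    have ha₀' : 0 < a := by exact_mod_cast ha₀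
    obtain rfl : a = 1 := by omega
    simpa using hka
  · have hb' : (0 : ℝ) < b := by exact_mod_cast hb
    have : (0 : ℝ) < a := by nlinarith
    have ha : 0 < a := by exact_mod_cast this
    nlinarith

theorem goldenConj_pow_odd_neg (j : ℕ) : Real.goldenConj ^ (2 * j + 1) < 0 :=
  Odd.pow_neg ⟨j, rfl⟩ Real.goldenConj_neg

theorem goldenConj_pow_even_pos (j : ℕ) : 0 < Real.goldenConj ^ (2 * j + 2) :=
  Even.pow_pos ⟨j + 1, by ring⟩ Real.goldenConj_neg.ne

theorem abs_goldenConj_pow_lt_one {n : ℕ} (hn : n ≠ 0) : |Real.goldenConj ^ n| < 1 := by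
  rw [abs_pow]
  refine pow_lt_one₀ (abs_nonneg _) (abs_lt.2 ⟨Real.neg_one_lt_goldenConj, ?_⟩) hn
  linarith [Real.goldenConj_neg]

theorem upperW_fib_odd (j : ℕ) : upperW (Nat.fib (2 * j + 1)) = Nat.fib (2 * j + 3) := by
  have h := goldenConj_pow_odd_neg j
  have h' := abs_lt.1 (abs_goldenConj_pow_lt_one (n := 2 * j + 1) (by omega))
  apply upperW_eq <;> rw [fib_mul_phi_sq] <;> linarith [h'.1]

theorem upperFract_fib_odd (j : ℕ) :
    upperFract (Nat.fib (2 * j + 1)) = -Real.goldenConj ^ (2 * j + 1) := by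
  rw [upperFract, upperW_fib_odd, fib_mul_phi_sq]
  ring

theorem upperW_fib_even (j : ℕ) : upperW (Nat.fib (2 * j + 2)) + 1 = Nat.fib (2 * j + 4) := by
  have h := goldenConj_pow_even_pos j
  have h' := abs_lt.1 (abs_goldenConj_pow_lt_one (n := 2 * j + 2) (by omega))
  obtain ⟨m, hm⟩ := Nat.exists_eq_succ_of_ne_zero (Nat.fib_pos.2 (by omega : 0 < 2 * j + 4)).ne'
  rw [hm, Nat.succ_eq_add_one, Nat.add_right_cancel_iff]
  apply upperW_eq <;> rw [fib_mul_phi_sq, hm] <;> push_cast <;> linarith [h'.2]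

theorem upperFract_fib_even (j : ℕ) :
    upperFract (Nat.fib (2 * j + 2)) = 1 - Real.goldenConj ^ (2 * j + 2) := by
  have h : ((upperW (Nat.fib (2 * j + 2)) + 1 : ℕ) : ℝ) = Nat.fib (2 * j + 4) := by
    rw [upperW_fib_even]
  push_cast at h
  rw [upperFract, fib_mul_phi_sq]
  linarith

theorem eq_fib_odd_of_upperFract_le {j k : ℕ} (hk : 0 < k) (hkj : k < Nat.fib (2 * j + 3))
    (h : upperFract k ≤ upperFract (Nat.fib (2 * j + 1))) : k = Nat.fib (2 * j + 1) := by
  have hneg := goldenConj_pow_odd_neg j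
  rw [upperFract_fib_odd] at h
  refine eq_fib_of_approx hk hkj (upperW k) (θ := upperFract k / -Real.goldenConj ^ (2 * j + 1))
    ?_ (div_pos (upperFract_pos hk) (by linarith)) ((div_le_one (by linarith)).2 h)
  rw [mul_div_cancel₀ _ (by linarith)]
  simp [upperFract]

theorem eq_fib_even_of_le_upperFract {j k : ℕ} (hk : 0 < k) (hkj : k < Nat.fib (2 * j + 4))
    (h : upperFract (Nat.fib (2 * j + 2)) ≤ upperFract k) : k = Nat.fib (2 * j + 2) := by
  have hpos := goldenConj_pow_even_pos j
  rw [upperFract_fib_even] at h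
  refine eq_fib_of_approx hk hkj (upperW k + 1)
    (θ := (1 - upperFract k) / Real.goldenConj ^ (2 * j + 2)) ?_
    (div_pos (by linarith [upperFract_lt_one k]) hpos) ((div_le_one hpos).2 (by linarith))
  rw [neg_mul, mul_div_cancel₀ _ hpos.ne']
  simp only [upperFract]
  push_cast
  ring

theorem StrictMono.exists_le_lt_succ {f : ℕ → ℕ} (hf : StrictMono f) {i : ℕ} (hi : f 0 ≤ i) :
    ∃ j, f j ≤ i ∧ i < f (j + 1) := by
  classical
  have hex : ∃ j, i < f j := ⟨i + 1, hf.le_apply⟩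
  obtain ⟨j, hj⟩ := Nat.exists_eq_succ_of_ne_zero (n := Nat.find hex) fun h => by
    have := Nat.find_spec hex
    rw [h] at this
    omega
  refine ⟨j, not_lt.1 (Nat.find_min hex (by omega)), ?_⟩
  have := Nat.find_spec hex
  rwa [hj] at this

theorem strictMono_fib_odd : StrictMono fun j => Nat.fib (2 * j + 1) :=
  strictMono_nat_of_lt_succ fun j => by
    have h₁ : Nat.fib (2 * j + 3) = Nat.fib (2 * j + 1) + Nat.fib (2 * j + 2) := Nat.fib_add_two
    have h₂ : 0 < Nat.fib (2 * j + 2) := Nat.fib_pos.2 (by omega)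
    change Nat.fib (2 * j + 1) < Nat.fib (2 * j + 3)
    omega

theorem strictMono_fib_even : StrictMono fun j => Nat.fib (2 * j + 2) :=
  strictMono_nat_of_lt_succ fun j => by
    have h₁ : Nat.fib (2 * j + 4) = Nat.fib (2 * j + 2) + Nat.fib (2 * j + 3) := Nat.fib_add_two
    have h₂ : 0 < Nat.fib (2 * j + 3) := Nat.fib_pos.2 (by omega)
    change Nat.fib (2 * j + 2) < Nat.fib (2 * j + 4)
    omega

theorem exists_upperFract_lt_iff {i : ℕ} (hi : 0 < i) :
    (∃ k, 0 < k ∧ k < i ∧ upperFract k < upperFract i) ↔ ∀ j, Nat.fib (2 * j + 1) ≠ i := by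
  constructor
  · rintro ⟨k, hk, hki, h⟩ j rfl
    exact hki.ne (eq_fib_odd_of_upperFract_le hk
      (hki.trans (strictMono_fib_odd j.lt_succ_self)) h.le)
  · intro h
    obtain ⟨j, hj, hj'⟩ := strictMono_fib_odd.exists_le_lt_succ (i := i) hi
    refine ⟨_, Nat.fib_pos.2 (by omega), lt_of_le_of_ne hj (h j), ?_⟩
    by_contra! hle
    exact h j (eq_fib_odd_of_upperFract_le hi hj' hle).symm

theorem exists_lt_upperFract_iff {i : ℕ} (hi : 0 < i) :
    (∃ k, 0 < k ∧ k < i ∧ upperFract i < upperFract k) ↔ ∀ j, Nat.fib (2 * j + 2) ≠ i := by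
  constructor
  · rintro ⟨k, hk, hki, h⟩ j rfl
    exact hki.ne (eq_fib_even_of_le_upperFract hk
      (hki.trans (strictMono_fib_even j.lt_succ_self)) h.le)
  · intro h
    obtain ⟨j, hj, hj'⟩ := strictMono_fib_even.exists_le_lt_succ (i := i) hi
    refine ⟨_, Nat.fib_pos.2 (by omega), lt_of_le_of_ne hj (h j), ?_⟩
    by_contra! hle
    exact h j (eq_fib_even_of_le_upperFract hi hj' hle).symm

theorem mem_upper_add_upper_iff (m : ℕ) :
    (∃ a ∈ upperWythoff, ∃ b ∈ upperWythoff, m = a + b) ↔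
      (∃ i, 0 < i ∧ (∀ j, Nat.fib (2 * j + 1) ≠ i) ∧ upperW i = m) ∨
      ∃ i, 0 < i ∧ (∀ j, Nat.fib (2 * j + 2) ≠ i) ∧ upperW i = m + 1 := by
  constructor
  · rintro ⟨_, ⟨k, hk, rfl⟩, _, ⟨l, hl, rfl⟩, rfl⟩
    rcases upperW_add_cases k l with ⟨h, -⟩ | ⟨h, -⟩
    · exact .inl ⟨k + l, by omega, (exists_upperFract_lt_iff (by omega)).1
        ((exists_add_eq_upperW_iff _).1 ⟨k, l, hk, hl, h.symm⟩), h⟩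
    · exact .inr ⟨k + l, by omega, (exists_lt_upperFract_iff (by omega)).1
        ((exists_add_add_one_eq_upperW_iff _).1 ⟨k, l, hk, hl, h.symm⟩), h⟩
  · rintro (⟨i, hi, h, hm⟩ | ⟨i, hi, h, hm⟩)
    · obtain ⟨k, l, hk, hl, hkl⟩ :=
        (exists_add_eq_upperW_iff _).2 ((exists_upperFract_lt_iff hi).2 h)
      exact ⟨_, ⟨k, hk, rfl⟩, _, ⟨l, hl, rfl⟩, hm.symm.trans hkl.symm⟩
    · obtain ⟨k, l, hk, hl, hkl⟩ :=
        (exists_add_add_one_eq_upperW_iff _).2 ((exists_lt_upperFract_iff hi).2 h)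
      exact ⟨_, ⟨k, hk, rfl⟩, _, ⟨l, hl, rfl⟩,
        Nat.add_right_cancel (hm.symm.trans hkl.symm)⟩

/-- If `upperW i < x` exactly for `i ≤ N` and `upperW i ≤ x` exactly for `i ≤ M`, then the sumset
below `x` consists of the `upperW i` with `i ≤ N` and the `upperW i - 1` with `i ≤ M`, where in each
family the first `r` Fibonacci indices of one parity are left out. -/
theorem ncard_upper_add_upper_lt {x N M r : ℕ} (hN : ∀ i, upperW i < x ↔ i ≤ N)
    (hM : ∀ i, upperW i ≤ x ↔ i ≤ M)
    (hrN : ∀ j, Nat.fib (2 * j + 1) ≤ N ↔ j < r) (hrM : ∀ j, Nat.fib (2 * j + 2) ≤ M ↔ j < r) :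
    {m : ℕ | m < x ∧ ∃ a ∈ upperWythoff, ∃ b ∈ upperWythoff, m = a + b}.ncard + 2 * r
      = N + M := by
  classical
  set P := (Finset.range r).image fun j => Nat.fib (2 * j + 1) with hP
  set Q := (Finset.range r).image fun j => Nat.fib (2 * j + 2) with hQ
  have hPs : P ⊆ Finset.Icc 1 N := by
    intro i hi
    obtain ⟨j, hj, rfl⟩ := Finset.mem_image.1 hi
    exact Finset.mem_Icc.2 ⟨Nat.fib_pos.2 (by omega), (hrN j).2 (Finset.mem_range.1 hj)⟩
  have hQs : Q ⊆ Finset.Icc 1 M := by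
    intro i hi
    obtain ⟨j, hj, rfl⟩ := Finset.mem_image.1 hi
    exact Finset.mem_Icc.2 ⟨Nat.fib_pos.2 (by omega), (hrM j).2 (Finset.mem_range.1 hj)⟩
  have hPc : P.card = r := by
    rw [hP, Finset.card_image_of_injective _ strictMono_fib_odd.injective, Finset.card_range]
  have hQc : Q.card = r := by
    rw [hQ, Finset.card_image_of_injective _ strictMono_fib_even.injective, Finset.card_range]
  have hset : {m : ℕ | m < x ∧ ∃ a ∈ upperWythoff, ∃ b ∈ upperWythoff, m = a + b} =
      ↑((Finset.Icc 1 N \ P).image upperW ∪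
        (Finset.Icc 1 M \ Q).image fun i => upperW i - 1) := by
    ext m
    simp only [Set.mem_ofPred_eq, mem_upper_add_upper_iff, Finset.coe_union, Finset.coe_image,
      Set.mem_union, Set.mem_image, Finset.mem_coe, Finset.mem_sdiff, Finset.mem_Icc, hP, hQ,
      Finset.mem_image, Finset.mem_range, not_exists, not_and]
    constructor
    · rintro ⟨hm, ⟨i, hi, h, rfl⟩ | ⟨i, hi, h, him⟩⟩
      · exact .inl ⟨i, ⟨⟨hi, (hN i).1 hm⟩, fun j _ => h j⟩, rfl⟩
      · exact .inr ⟨i, ⟨⟨hi, (hM i).1 (by omega)⟩, fun j _ => h j⟩, by omega⟩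
    · rintro (⟨i, ⟨⟨hi, hiN⟩, h⟩, rfl⟩ | ⟨i, ⟨⟨hi, hiM⟩, h⟩, rfl⟩)
      · exact ⟨(hN i).2 hiN, .inl ⟨i, hi, fun j hj => h j ((hrN j).1 (hj ▸ hiN)) hj, rfl⟩⟩
      · have := two_le_upperW hi
        have := (hM i).2 hiM
        exact ⟨by omega, .inr ⟨i, hi, fun j hj => h j ((hrM j).1 (hj ▸ hiM)) hj, by omega⟩⟩
  have hdisj : Disjoint ((Finset.Icc 1 N \ P).image upperW)
      ((Finset.Icc 1 M \ Q).image fun i => upperW i - 1) := by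
    rw [Finset.disjoint_left]
    intro m hm hm'
    obtain ⟨i, -, rfl⟩ := Finset.mem_image.1 hm
    obtain ⟨k, hk, hki⟩ := Finset.mem_image.1 hm'
    have := two_le_upperW (Finset.mem_Icc.1 (Finset.mem_sdiff.1 hk).1).1
    exact upperW_ne_add_one k i (by omega)
  have hinj : Set.InjOn (fun i => upperW i - 1) ↑(Finset.Icc 1 M \ Q) := by
    intro i hi k hk h
    have h₁ := two_le_upperW (Finset.mem_Icc.1 (Finset.mem_sdiff.1 hi).1).1
    have h₂ := two_le_upperW (Finset.mem_Icc.1 (Finset.mem_sdiff.1 hk).1).1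
    refine upperW_strictMono.injective ?_
    simp only at h
    omega
  rw [hset, Set.ncard_coe_finset, Finset.card_union_of_disjoint hdisj,
    Finset.card_image_of_injective _ upperW_strictMono.injective, Finset.card_image_of_injOn hinj]
  have h₁ := Finset.card_sdiff_add_card_eq_card hPs
  have h₂ := Finset.card_sdiff_add_card_eq_card hQs
  rw [Nat.card_Icc] at h₁ h₂
  omega

/-- The number of elements of `U + U` below `F_n` is `2·F_{n-2} + 2 - n` for `n ≥ 4`. -/
theorem card_upper_add_upper_lt_fib (n : ℕ) (hn : 4 ≤ n) :
    {m : ℕ | m < Nat.fib n ∧ ∃ a ∈ upperWythoff, ∃ b ∈ upperWythoff, m = a + b}.ncard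
      = 2 * Nat.fib (n - 2) + 2 - n := by
  rcases Nat.even_or_odd' n with ⟨c, rfl | rfl⟩
  · obtain ⟨r, rfl⟩ := Nat.exists_eq_add_of_le (show 2 ≤ c by omega)
    rw [show 2 * (2 + r) = 2 * r + 4 by ring, show 2 * r + 4 - 2 = 2 * r + 2 by omega]
    have hu := upperW_fib_even r
    have hfib : ∀ i, upperW i < Nat.fib (2 * r + 4) ↔ i ≤ Nat.fib (2 * r + 2) := fun i => by
      rw [← hu, Nat.lt_succ_iff, upperW_strictMono.le_iff_le]
    have h := ncard_upper_add_upper_lt (r := r + 1) hfib (M := Nat.fib (2 * r + 2))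
      (fun i => by
        rw [← hfib, le_iff_lt_or_eq, or_iff_left]
        rw [← hu]
        exact upperW_ne_add_one _ _)
      (fun j => by
        constructor
        · intro hj
          by_contra! hlt
          have h₁ := strictMono_fib_odd.monotone hlt
          have h₂ : Nat.fib (2 * r + 3) = Nat.fib (2 * r + 1) + Nat.fib (2 * r + 2) :=
            Nat.fib_add_two
          have h₃ : 0 < Nat.fib (2 * r + 1) := Nat.fib_pos.2 (by omega)
          change Nat.fib (2 * r + 3) ≤ Nat.fib (2 * j + 1) at h₁
          omega
        · exact fun hj => Nat.fib_mono (by omega))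
      (fun j => by rw [strictMono_fib_even.le_iff_le (a := j) (b := r), Nat.lt_succ_iff])
    omega
  · obtain ⟨r, rfl⟩ := Nat.exists_eq_add_of_le (show 2 ≤ c by omega)
    rw [show 2 * (2 + r) + 1 = 2 * (r + 1) + 3 by ring,
      show 2 * (r + 1) + 3 - 2 = 2 * (r + 1) + 1 by omega]
    have hu := upperW_fib_odd (r + 1)
    have hpos : 0 < Nat.fib (2 * (r + 1) + 1) := Nat.fib_pos.2 (by omega)
    have h := ncard_upper_add_upper_lt (r := r + 1) (x := Nat.fib (2 * (r + 1) + 3))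
      (N := Nat.fib (2 * (r + 1) + 1) - 1) (M := Nat.fib (2 * (r + 1) + 1))
      (fun i => by rw [← hu, upperW_strictMono.lt_iff_lt]; omega)
      (fun i => by rw [← hu, upperW_strictMono.le_iff_le])
      (fun j => by
        rw [← strictMono_fib_odd.lt_iff_lt (a := j) (b := r + 1)]
        omega)
      (fun j => by
        constructor
        · intro hj
          by_contra! hlt
          have h₁ := strictMono_fib_even.monotone hlt
          have h₂ : Nat.fib (2 * r + 4) = Nat.fib (2 * r + 2) + Nat.fib (2 * r + 3) :=
            Nat.fib_add_two
          have h₃ : 0 < Nat.fib (2 * r + 2) := Nat.fib_pos.2 (by omega)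
          change Nat.fib (2 * r + 4) ≤ Nat.fib (2 * j + 2) at h₁
          change _ ≤ Nat.fib (2 * r + 3) at hj
          omega
        · exact fun hj => Nat.fib_mono (by omega))
    omega
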